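/- arXiv:0707.4202 — 7 statements merged into one kernel-verified Lean document; each statement's English description precedes it below -/
import Mathlib

section
/- Let (A,S) and (Ã,S) be admissible arrival–service pairs (with the same service set S) such that Ã ⊆ A. Then D(Ã,S) ⊆ D(A,S). -/
open Set Filter

noncomputable section

/-- A subset of `ℝ` is locally finite if its intersection with every bounded interval
is finite. -/
def LocFin (B : Set ℝ) : Prop := ∀ a b : ℝ, (B ∩ Set.Icc a b).Finite

/-- The right-continuous random-walk function `Z` associated to arrivals `A` and services `S`:
`Z 0 = 0` and `Z s - Z r = |A ∩ (r,s]| - |S ∩ (r,s]|` for `r < s`;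
`Z` jumps up by 1 at points of `A` and down by 1 at points of `S`. -/
def Zfun (A S : Set ℝ) (r : ℝ) : ℤ :=
  if 0 ≤ r then ((A ∩ Set.Ioc 0 r).ncard : ℤ) - ((S ∩ Set.Ioc 0 r).ncard : ℤ)
  else ((S ∩ Set.Ioc r 0).ncard : ℤ) - ((A ∩ Set.Ioc r 0).ncard : ℤ)

/-- The pair `(A,S)` is admissible: both sets locally finite and disjoint, and
`Z_r → -∞` as `r → ∞`, `Z_r → +∞` as `r → -∞`. -/
def Admissible (A S : Set ℝ) : Prop :=
  LocFin A ∧ LocFin S ∧ Disjoint A S ∧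
  Tendsto (Zfun A S) atTop atBot ∧ Tendsto (Zfun A S) atBot atTop

/-- Unused service times: times `r ∈ S` where `Z` attains a new record down, i.e.
`Z r < Z r'` for all `r' < r` (equivalently `Z_r < inf_{r' < r} Z_{r'}`). -/
def Unused (A S : Set ℝ) : Set ℝ := {r ∈ S | ∀ r' < r, Zfun A S r < Zfun A S r'}

/-- Departure times: service times that are not unused. -/
def Dep (A S : Set ℝ) : Set ℝ := S \ Unused A S

/-- `B` has two-sided density `ρ`. -/
def HasDens (B : Set ℝ) (ρ : ℝ) : Prop :=
  Tendsto (fun s : ℝ => ((B ∩ Set.Icc 0 s).ncard : ℝ) / s) atTop (nhds ρ) ∧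
  Tendsto (fun s : ℝ => ((B ∩ Set.Icc (-s) 0).ncard : ℝ) / s) atTop (nhds ρ)

/-- The queue length `Q_r = Z_r - min_{r' ≤ r} Z_{r'}`. -/
def Qlen (A S : Set ℝ) (r : ℝ) : ℤ := Zfun A S r - sInf (Zfun A S '' Set.Iic r)

/-- `Dseq α k m = D^{(m+1)}(α_k, α_{k+1}, …, α_{k+m})`, the tandem departure operator:
`D^{(1)}(α¹) = α¹` and `D^{(n)}(α¹,…,αⁿ) = D(D^{(n-1)}(α¹,…,α^{n-1}), αⁿ)`. -/
def Dseq (α : ℕ → Set ℝ) (k : ℕ) : ℕ → Set ℝ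
  | 0 => α k
  | m + 1 => Dep (Dseq α k m) (α (k + m + 1))

theorem ncard_split (B : Set ℝ) (hB : LocFin B) {a b c : ℝ} (h1 : a ≤ b) (h2 : b ≤ c) :
    (B ∩ Set.Ioc a c).ncard = (B ∩ Set.Ioc a b).ncard + (B ∩ Set.Ioc b c).ncard := by
  rw [← Set.Ioc_union_Ioc_eq_Ioc h1 h2, Set.inter_union_distrib_left]
  apply Set.ncard_union_eq
  · rw [Set.disjoint_left]
    rintro x ⟨_, hx⟩ ⟨_, hy⟩
    exact absurd hx.2 (not_le.mpr hy.1)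
  · exact (hB a b).subset (Set.inter_subset_inter_right _ Set.Ioc_subset_Icc_self)
  · exact (hB b c).subset (Set.inter_subset_inter_right _ Set.Ioc_subset_Icc_self)

theorem Zfun_incr (A S : Set ℝ) (hA : LocFin A) (hS : LocFin S) {r s : ℝ} (h : r < s) :
    Zfun A S s - Zfun A S r
      = ((A ∩ Set.Ioc r s).ncard : ℤ) - ((S ∩ Set.Ioc r s).ncard : ℤ) := by
  unfold Zfun
  by_cases hs : 0 ≤ s
  · by_cases hr : 0 ≤ r
    · have a := ncard_split A hA hr h.le
      have b := ncard_split S hS hr h.le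
      rw [if_pos hs, if_pos hr]
      omega
    · have a := ncard_split A hA (not_le.mp hr).le hs
      have b := ncard_split S hS (not_le.mp hr).le hs
      rw [if_pos hs, if_neg hr]
      omega
  · have hr : ¬ 0 ≤ r := fun hr => hs (hr.trans h.le)
    have a := ncard_split A hA h.le (not_le.mp hs).le
    have b := ncard_split S hS h.le (not_le.mp hs).le
    rw [if_neg hs, if_neg hr]
    omega

/-- If `(A,S)` and `(Ã,S)` are admissible arrival–service pairs with the same
service set `S` and `Ã ⊆ A`, then `D(Ã,S) ⊆ D(A,S)`. -/
theorem departures_mono (A At S : Set ℝ)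
    (hAS : Admissible A S) (hAtS : Admissible At S) (hsub : At ⊆ A) :
    Dep At S ⊆ Dep A S := by
  rintro r ⟨hrS, hr⟩
  refine ⟨hrS, fun hU => hr ⟨hrS, fun r' hr' => ?_⟩⟩
  have h1 := hU.2 r' hr'
  have h2 := Zfun_incr A S hAS.1 hAS.2.1 hr'
  have h3 := Zfun_incr At S hAtS.1 hAtS.2.1 hr'
  have h4 : (At ∩ Set.Ioc r' r).ncard ≤ (A ∩ Set.Ioc r' r).ncard :=
    Set.ncard_le_ncard (Set.inter_subset_inter_left _ hsub)
      ((hAS.1 r' r).subset (Set.inter_subset_inter_right _ Set.Ioc_subset_Icc_self))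
  omega
end
end

section
/- Let α¹, …, αⁿ be pairwise disjoint locally finite subsets of ℝ such that α^k has two-sided density ρ^k, where 0 < ρ¹ < ρ² < … < ρⁿ. Then every arrival–service pair arising in the recursive definition of the tandem departure operators D^{(k)} is admissible, for each k the configuration η^k := D^{(n−k+1)}(α^k, α^{k+1}, …, αⁿ) has two-sided density ρ^k, and the chain of inclusions D^{(n)}(α¹,…,αⁿ) ⊆ D^{(n−1)}(α²,…,αⁿ) ⊆ … ⊆ D^{(1)}(αⁿ) = αⁿ holds; equivalently, η^k ⊆ η^{k+1} for k = 1, …, n−1. -/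
open Set Filter

noncomputable section

def Ncnt (B : Set ℝ) (r : ℝ) : ℤ :=
  if 0 ≤ r then ((B ∩ Set.Ioc 0 r).ncard : ℤ) else -((B ∩ Set.Ioc r 0).ncard : ℤ)

lemma LocFin.ioc {B : Set ℝ} (h : LocFin B) (a b : ℝ) : (B ∩ Set.Ioc a b).Finite :=
  (h a b).subset (inter_subset_inter_right _ Ioc_subset_Icc_self)

lemma LocFin.mono {B C : Set ℝ} (h : LocFin B) (hc : C ⊆ B) : LocFin C :=
  fun a b => (h a b).subset (inter_subset_inter_left _ hc)

lemma Zfun_eq (A S : Set ℝ) (r : ℝ) : Zfun A S r = Ncnt A r - Ncnt S r := by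
  unfold Zfun Ncnt; split_ifs <;> ring

lemma ioc_split {B : Set ℝ} (h : LocFin B) {a b c : ℝ} (hab : a ≤ b) (hbc : b ≤ c) :
    (B ∩ Set.Ioc a c).ncard = (B ∩ Set.Ioc a b).ncard + (B ∩ Set.Ioc b c).ncard := by
  rw [← Ioc_union_Ioc_eq_Ioc hab hbc, inter_union_distrib_left]
  refine ncard_union_eq ?_ (h.ioc a b) (h.ioc b c)
  rw [Set.disjoint_left]
  rintro x ⟨_, h1⟩ ⟨_, h2⟩
  exact absurd h1.2 (not_le.2 h2.1)

lemma Ncnt_sub {B : Set ℝ} (h : LocFin B) {r s : ℝ} (hrs : r ≤ s) :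
    Ncnt B s - Ncnt B r = ((B ∩ Set.Ioc r s).ncard : ℤ) := by
  unfold Ncnt
  split_ifs with h1 h2 h2
  · rw [ioc_split h h2 hrs]; push_cast; ring
  · rw [ioc_split h (le_of_not_ge h2) h1]; push_cast; ring
  · linarith
  · rw [ioc_split h hrs (le_of_not_ge h1)]; push_cast; ring

lemma Ncnt_mono {B : Set ℝ} (h : LocFin B) {r s : ℝ} (hrs : r ≤ s) :
    Ncnt B r ≤ Ncnt B s := by
  have := Ncnt_sub h hrs
  omega

lemma Ncnt_diff {B C : Set ℝ} (h : LocFin B) (hc : C ⊆ B) (r : ℝ) :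
    Ncnt (B \ C) r = Ncnt B r - Ncnt C r := by
  have key : ∀ a b : ℝ, ((B ∩ Set.Ioc a b).ncard : ℤ)
      = (C ∩ Set.Ioc a b).ncard + ((B \ C) ∩ Set.Ioc a b).ncard := by
    intro a b
    rw [← Nat.cast_add, ← ncard_union_eq _ ((h.mono hc).ioc a b) ((h.mono diff_subset).ioc a b),
      ← union_inter_distrib_right, union_diff_cancel hc]
    rw [Set.disjoint_left]
    rintro x ⟨h1, _⟩ ⟨h2, _⟩
    exact h2.2 h1
  unfold Ncnt
  split_ifs
  · rw [key]; ring
  · rw [key]; ring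

lemma Dep_mono {A A' S : Set ℝ} (h : LocFin A') (hA : A ⊆ A') : Dep A S ⊆ Dep A' S := by
  rintro x ⟨hx, hu⟩
  refine ⟨hx, fun hu' => hu ⟨hx, fun y hy => ?_⟩⟩
  have h1 := hu'.2 y hy
  have h2 := Ncnt_mono (h.mono (diff_subset : A' \ A ⊆ A')) hy.le
  rw [Ncnt_diff h hA, Ncnt_diff h hA] at h2
  simp only [Zfun_eq] at *
  omega

/-- Density via `Ncnt`. -/
def Dens2 (B : Set ℝ) (ρ : ℝ) : Prop :=
  Tendsto (fun r : ℝ => (Ncnt B r : ℝ) / r) atTop (nhds ρ) ∧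
  Tendsto (fun r : ℝ => (Ncnt B r : ℝ) / r) atBot (nhds ρ)

lemma close_div {f g : ℝ → ℝ} (h : ∀ s, 0 < s → |f s - g s| ≤ 1) :
    Tendsto (fun s => f s / s - g s / s) atTop (nhds 0) := by
  refine squeeze_zero_norm' ?_ (tendsto_inv_atTop_zero (𝕜 := ℝ))
  filter_upwards [eventually_gt_atTop 0] with s hs
  rw [← sub_div, Real.norm_eq_abs, abs_div, abs_of_pos hs, ← one_div]
  exact div_le_div_of_nonneg_right (h s hs) hs.le

lemma close_iff {f g : ℝ → ℝ} {ρ : ℝ} (h : ∀ s, 0 < s → |f s - g s| ≤ 1) :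
    Tendsto (fun s => f s / s) atTop (nhds ρ) ↔ Tendsto (fun s => g s / s) atTop (nhds ρ) := by
  have := close_div h
  constructor
  · intro hf
    simpa using hf.sub this
  · intro hf
    simpa using hf.add this

lemma icc_ioc {B : Set ℝ} (h : LocFin B) {a b : ℝ} (hab : a ≤ b) :
    |((B ∩ Set.Icc a b).ncard : ℝ) - ((B ∩ Set.Ioc a b).ncard : ℝ)| ≤ 1 := by
  have h1 : (B ∩ Set.Ioc a b).ncard ≤ (B ∩ Set.Icc a b).ncard :=
    ncard_le_ncard (inter_subset_inter_right _ Ioc_subset_Icc_self) (h a b)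
  have h2 : (B ∩ Set.Icc a b).ncard ≤ (B ∩ Set.Ioc a b).ncard + 1 := by
    refine (ncard_le_ncard (t := insert a (B ∩ Set.Ioc a b)) ?_ ((h.ioc a b).insert a)).trans
      (ncard_insert_le _ _)
    rintro x ⟨hx, hx1, hx2⟩
    rcases hx1.eq_or_lt with e | e
    · exact Or.inl e.symm
    · exact Or.inr ⟨hx, e, hx2⟩
  have h1' : ((B ∩ Set.Ioc a b).ncard : ℝ) ≤ (B ∩ Set.Icc a b).ncard := by exact_mod_cast h1
  have h2' : ((B ∩ Set.Icc a b).ncard : ℝ) ≤ (B ∩ Set.Ioc a b).ncard + 1 := by exact_mod_cast h2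
  rw [abs_le]; constructor <;> linarith

lemma hasDens_iff {B : Set ℝ} (h : LocFin B) (ρ : ℝ) : HasDens B ρ ↔ Dens2 B ρ := by
  unfold HasDens Dens2
  refine and_congr ?_ ?_
  · apply close_iff
    intro s hs
    have := icc_ioc h hs.le
    simpa [Ncnt, hs.le] using this
  · have e : Tendsto (fun r : ℝ => (Ncnt B r : ℝ) / r) atBot (nhds ρ) ↔
        Tendsto (fun s : ℝ => (-(Ncnt B (-s)) : ℝ) / s) atTop (nhds ρ) := by
      rw [← Filter.map_neg_atTop, Filter.tendsto_map'_iff]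
      refine tendsto_congr fun s => ?_
      simp [div_neg, neg_div]
    rw [e]
    apply close_iff (g := fun s => (-(Ncnt B (-s)) : ℝ))
    intro s hs
    have := icc_ioc h (neg_nonpos.2 hs.le)
    simpa [Ncnt, not_le.2 hs] using this

section Walk
variable {A S : Set ℝ}

lemma Z_drop (hA : LocFin A) (hS : LocFin S) {r s : ℝ} (hrs : r ≤ s) :
    Zfun A S r - ((S ∩ Set.Ioc r s).ncard : ℤ) ≤ Zfun A S s := by
  have h1 := Ncnt_sub hS hrs
  have h2 := Ncnt_mono hA hrs
  simp only [Zfun_eq]; omega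

lemma Z_bdd (h : Admissible A S) (r : ℝ) : BddBelow (Zfun A S '' Set.Iic r) := by
  obtain ⟨hA, hS, -, -, hb⟩ := h
  obtain ⟨x0, hx0⟩ := eventually_atBot.1 (hb.eventually_ge_atTop 0)
  refine ⟨min 0 (Zfun A S x0 - ((S ∩ Set.Ioc x0 r).ncard : ℤ)), ?_⟩
  rintro _ ⟨x, hx, rfl⟩
  rcases le_total x x0 with e | e
  · exact (min_le_left _ _).trans (hx0 x e)
  · refine (min_le_right _ _).trans (le_trans ?_ (Z_drop hA hS e))
    have : (S ∩ Set.Ioc x0 x).ncard ≤ (S ∩ Set.Ioc x0 r).ncard :=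
      ncard_le_ncard (inter_subset_inter_right _ (Ioc_subset_Ioc_right hx)) (hS.ioc _ _)
    omega

/-- running minimum -/
def Imin (A S : Set ℝ) (r : ℝ) : ℤ := sInf (Zfun A S '' Set.Iic r)

lemma Imin_le (h : Admissible A S) {x r : ℝ} (hx : x ≤ r) : Imin A S r ≤ Zfun A S x :=
  csInf_le (Z_bdd h r) ⟨x, hx, rfl⟩

lemma Imin_mem (h : Admissible A S) (r : ℝ) : ∃ x ≤ r, Zfun A S x = Imin A S r := by
  obtain ⟨x, hx, e⟩ := Int.csInf_mem (s := Zfun A S '' Set.Iic r) ⟨_, r, self_mem_Iic, rfl⟩ (Z_bdd h r)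
  exact ⟨x, hx, e⟩

/-- gaps on the right and left of a point -/
lemma gap_right {B : Set ℝ} (h : LocFin B) (t : ℝ) : ∃ y > t, B ∩ Set.Ioc t y = ∅ := by
  have hf := h.ioc t (t+1)
  rcases (B ∩ Set.Ioc t (t+1)).eq_empty_or_nonempty with e | e
  · exact ⟨t+1, by simp, e⟩
  · obtain ⟨m, hm, hmin⟩ := Set.exists_min_image _ id hf e
    have hm1 := hm.2.1
    refine ⟨(t+m)/2, by simp only [gt_iff_lt]; linarith, ?_⟩
    rw [Set.eq_empty_iff_forall_notMem]
    rintro x ⟨hx, h1, h2⟩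
    have := hmin x ⟨hx, h1, by linarith [hm.2.2]⟩
    simp only [id] at this
    linarith

lemma gap_left {B : Set ℝ} (h : LocFin B) (t : ℝ) : ∃ y < t, B ∩ Set.Ioc y t ⊆ {t} := by
  have hf : (B ∩ Set.Ico (t-1) t).Finite := (h (t-1) t).subset
    (inter_subset_inter_right _ Ico_subset_Icc_self)
  rcases (B ∩ Set.Ico (t-1) t).eq_empty_or_nonempty with e | e
  · refine ⟨t-1, by simp, ?_⟩
    rintro x ⟨hx, h1, h2⟩
    by_contra hne
    exact Set.eq_empty_iff_forall_notMem.1 e x ⟨hx, h1.le, lt_of_le_of_ne h2 hne⟩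
  · obtain ⟨m, hm, hmax⟩ := Set.exists_max_image _ id hf e
    refine ⟨m, hm.2.2, ?_⟩
    rintro x ⟨hx, h1, h2⟩
    by_contra hne
    have := hmax x ⟨hx, by linarith [hm.2.1], lt_of_le_of_ne h2 hne⟩
    simp only [id] at this
    linarith

lemma Z_hit (h : Admissible A S) {r t : ℝ} {v : ℤ} (h1 : Imin A S t ≤ v) (h2 : v < Imin A S r) :
    ∃ u ∈ Unused A S ∩ Set.Ioc r t, Zfun A S u = v := by
  obtain ⟨hA, hS, -⟩ := id h
  obtain ⟨x, hxt, hx⟩ := Imin_mem h t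
  set T : Set ℝ := {y | Zfun A S y ≤ v} with hT
  have hlow : ∀ y ∈ T, r < y := by
    intro y hy
    by_contra hc
    have := Imin_le h (not_lt.1 hc)
    have hy' : Zfun A S y ≤ v := hy
    omega
  have hbdd : BddBelow T := ⟨r, fun y hy => (hlow y hy).le⟩
  have hxT : x ∈ T := by show Zfun A S x ≤ v; omega
  have hne : T.Nonempty := ⟨x, hxT⟩
  set τ := sInf T with hτ
  have hbelow : ∀ y < τ, v < Zfun A S y := by
    intro y hy
    by_contra hc
    exact absurd (csInf_le hbdd (not_lt.1 hc)) (not_le.2 hy)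
  have hτT : Zfun A S τ ≤ v := by
    obtain ⟨y, hy, hg⟩ := gap_right hS τ
    obtain ⟨w, hw, hwy⟩ := exists_lt_of_csInf_lt hne hy
    have hle : τ ≤ w := csInf_le hbdd hw
    have hd := Z_drop hA hS hle
    have : S ∩ Set.Ioc τ w = ∅ := by
      rw [← subset_empty_iff, ← hg]
      exact inter_subset_inter_right _ (Ioc_subset_Ioc_right hwy.le)
    rw [this, ncard_empty] at hd
    have hw' : Zfun A S w ≤ v := hw
    omega
  obtain ⟨y, hy, hg⟩ := gap_left hS τ
  have hd := Z_drop hA hS hy.le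
  have hvy := hbelow y hy
  have hcard : (S ∩ Set.Ioc y τ).ncard ≤ 1 := by
    simpa using ncard_le_ncard hg (finite_singleton τ)
  have hZ : Zfun A S τ = v := by omega
  have hmem : τ ∈ S := by
    by_contra hc
    have : S ∩ Set.Ioc y τ = ∅ := by
      rw [Set.eq_empty_iff_forall_notMem]
      intro z hz
      have := hg hz
      rw [mem_singleton_iff] at this
      exact hc (this ▸ hz.1)
    rw [this, ncard_empty] at hd
    omega
  refine ⟨τ, ⟨⟨hmem, fun z hz => ?_⟩, hlow τ hτT, (csInf_le hbdd hxT).trans hxt⟩, hZ⟩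
  rw [hZ]; exact hbelow z hz

lemma U_count (h : Admissible A S) {r t : ℝ} (hrt : r ≤ t) :
    ((Unused A S ∩ Set.Ioc r t).ncard : ℤ) = Imin A S r - Imin A S t := by
  have himg : Zfun A S '' (Unused A S ∩ Set.Ioc r t) = (Finset.Ico (Imin A S t) (Imin A S r) : Set ℤ) := by
    ext v
    simp only [Finset.coe_Ico, mem_image, Set.mem_Ico]
    constructor
    · rintro ⟨u, ⟨hu, hu1, hu2⟩, rfl⟩
      refine ⟨Imin_le h hu2, ?_⟩
      obtain ⟨x, hx, e⟩ := Imin_mem h r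
      rw [← e]
      exact hu.2 x (lt_of_le_of_lt hx hu1)
    · rintro ⟨h1, h2⟩
      exact Z_hit h h1 h2
  have hinj : Set.InjOn (Zfun A S) (Unused A S ∩ Set.Ioc r t) := by
    intro u hu w hw e
    rcases lt_trichotomy u w with l | l | l
    · exact absurd e (hw.1.2 u l).ne'
    · exact l
    · exact absurd e (hu.1.2 w l).ne
  rw [← ncard_image_of_injOn hinj, himg, ncard_coe_finset, Int.card_Ico]
  have : Imin A S t ≤ Imin A S r := by
    obtain ⟨x, hx, e⟩ := Imin_mem h r
    rw [← e]; exact Imin_le h (hx.trans hrt)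
  omega

lemma N_Unused (h : Admissible A S) (r : ℝ) :
    Ncnt (Unused A S) r = Imin A S 0 - Imin A S r := by
  unfold Ncnt
  split_ifs with h0
  · exact U_count h h0
  · rw [U_count h (le_of_not_ge h0)]; ring

lemma Z_div {a s : ℝ} {l : Filter ℝ}
    (hA : Tendsto (fun r : ℝ => (Ncnt A r : ℝ) / r) l (nhds a))
    (hS : Tendsto (fun r : ℝ => (Ncnt S r : ℝ) / r) l (nhds s)) :
    Tendsto (fun r : ℝ => (Zfun A S r : ℝ) / r) l (nhds (a - s)) := by
  refine (hA.sub hS).congr fun r => ?_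
  rw [Zfun_eq]; push_cast; ring

lemma adm_of_dens (hA : LocFin A) (hS : LocFin S) (hd : Disjoint A S) {a s : ℝ} (has : a < s)
    (dA : Dens2 A a) (dS : Dens2 S s) : Admissible A S := by
  have hneg : a - s < 0 := by linarith
  refine ⟨hA, hS, hd, ?_, ?_⟩
  · rw [← tendsto_intCast_atBot_iff (R := ℝ)]
    refine ((Z_div dA.1 dS.1).neg_mul_atTop hneg tendsto_id).congr' ?_
    filter_upwards [eventually_gt_atTop 0] with r hr
    simp only [id]; field_simp
  · rw [← tendsto_intCast_atTop_iff (R := ℝ)]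
    refine ((Z_div dA.2 dS.2).neg_mul_atBot hneg tendsto_id).congr' ?_
    filter_upwards [eventually_lt_atBot 0] with r hr
    have := hr.ne
    simp only [id]; field_simp

lemma I_top (h : Admissible A S) {d : ℝ} (hd : d < 0)
    (hZ : Tendsto (fun r : ℝ => (Zfun A S r : ℝ) / r) atTop (nhds d)) :
    Tendsto (fun r : ℝ => (Imin A S r : ℝ) / r) atTop (nhds d) := by
  rw [tendsto_order]
  constructor
  · intro b hb
    obtain ⟨b', hb1, hb2⟩ := exists_between hb
    obtain ⟨R, hR⟩ := eventually_atTop.1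
      (((tendsto_order.1 hZ).1 b' hb2).and (eventually_gt_atTop 0))
    have hb0 : b' < 0 := hb2.trans hd
    have hlim : Tendsto (fun r : ℝ => b' * r) atTop atBot := tendsto_id.const_mul_atTop_of_neg hb0
    filter_upwards [eventually_gt_atTop 0, hlim.eventually_le_atBot (Imin A S R : ℝ)] with r hr hr2
    rw [lt_div_iff₀ hr]
    have : b' * r ≤ Imin A S r := by
      obtain ⟨x, hx, e⟩ := Imin_mem h r
      rw [← e]
      rcases le_total x R with hxR | hxR
      · refine hr2.trans ?_
        exact_mod_cast Imin_le h hxR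
      · obtain ⟨h1, h2⟩ := hR x hxR
        rw [lt_div_iff₀ h2] at h1
        nlinarith
    nlinarith
  · intro b hb
    filter_upwards [eventually_gt_atTop 0, (tendsto_order.1 hZ).2 b hb] with r hr h1
    refine lt_of_le_of_lt ?_ h1
    refine div_le_div_of_nonneg_right ?_ hr.le
    exact_mod_cast Imin_le h le_rfl

lemma I_bot (h : Admissible A S) {d : ℝ} (hd : d < 0)
    (hZ : Tendsto (fun r : ℝ => (Zfun A S r : ℝ) / r) atBot (nhds d)) :
    Tendsto (fun r : ℝ => (Imin A S r : ℝ) / r) atBot (nhds d) := by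
  rw [tendsto_order]
  constructor
  · intro b hb
    filter_upwards [eventually_lt_atBot 0, (tendsto_order.1 hZ).1 b hb] with r hr h1
    refine lt_of_lt_of_le h1 ?_
    refine div_le_div_of_nonpos_of_le hr.le ?_
    exact_mod_cast Imin_le h le_rfl
  · intro b hb
    obtain ⟨b', hb1, hb2⟩ := exists_between (lt_min hb hd)
    obtain ⟨R, hR⟩ := eventually_atBot.1
      (((tendsto_order.1 hZ).2 b' hb1).and (eventually_lt_atBot 0))
    have hb0 : b' < 0 := hb2.trans_le (min_le_right _ _)
    filter_upwards [eventually_lt_atBot 0, eventually_le_atBot R] with r hr hrR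
    refine lt_trans ?_ (hb2.trans_le (min_le_left _ _))
    rw [div_lt_iff_of_neg hr]
    obtain ⟨x, hx, e⟩ := Imin_mem h r
    rw [← e]
    obtain ⟨h1, h2⟩ := hR x (hx.trans hrR)
    rw [div_lt_iff_of_neg h2] at h1
    nlinarith

lemma dens_step {l : Filter ℝ} {s d : ℝ} (h : Admissible A S)
    (hl : Tendsto (fun r : ℝ => r⁻¹) l (nhds 0))
    (hS : Tendsto (fun r : ℝ => (Ncnt S r : ℝ) / r) l (nhds s))
    (hI : Tendsto (fun r : ℝ => (Imin A S r : ℝ) / r) l (nhds d)) :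
    Tendsto (fun r : ℝ => (Ncnt (Dep A S) r : ℝ) / r) l (nhds (s + d)) := by
  have := (hS.add hI).sub (hl.const_mul (Imin A S 0 : ℝ))
  rw [mul_zero, sub_zero] at this
  refine this.congr fun r => ?_
  rw [Dep, Ncnt_diff h.2.1 (fun x hx => hx.1), N_Unused h]
  push_cast; ring

lemma dens_Dep (h : Admissible A S) {a s : ℝ} (has : a < s)
    (dA : Dens2 A a) (dS : Dens2 S s) : Dens2 (Dep A S) a := by
  have hneg : a - s < 0 := by linarith
  have e : a = s + (a - s) := by ring
  rw [e]
  exact ⟨dens_step h tendsto_inv_atTop_zero dS.1 (I_top h hneg (Z_div dA.1 dS.1)),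
    dens_step h tendsto_inv_atBot_zero dS.2 (I_bot h hneg (Z_div dA.2 dS.2))⟩

end Walk

lemma Dseq_sub (α : ℕ → Set ℝ) (k m : ℕ) : Dseq α k m ⊆ α (k + m) := by
  cases m with
  | zero => exact subset_rfl
  | succ m => exact diff_subset

/-- For pairwise disjoint locally finite sets `α¹,…,αⁿ` with two-sided densities
`0 < ρ¹ < … < ρⁿ`, all arrival–service pairs in the recursive definition of the tandem
departure operators are admissible, `η^k = D^{(n-k+1)}(α^k,…,αⁿ)` has two-sided density `ρ^k`,
and `η^k ⊆ η^{k+1}` for `k = 1,…,n-1`. -/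
theorem tandem_admissible_density_nested (n : ℕ) (hn : 1 ≤ n) (α : ℕ → Set ℝ) (ρ : ℕ → ℝ)
    (hlf : ∀ k, 1 ≤ k → k ≤ n → LocFin (α k))
    (hdisj : ∀ k l, 1 ≤ k → k < l → l ≤ n → Disjoint (α k) (α l))
    (hdens : ∀ k, 1 ≤ k → k ≤ n → HasDens (α k) (ρ k))
    (hpos : 0 < ρ 1)
    (hmono : ∀ k, 1 ≤ k → k < n → ρ k < ρ (k + 1)) :
    (∀ k m, 1 ≤ k → k + m + 1 ≤ n → Admissible (Dseq α k m) (α (k + m + 1))) ∧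
    (∀ k, 1 ≤ k → k ≤ n → HasDens (Dseq α k (n - k)) (ρ k)) ∧
    (∀ k, 1 ≤ k → k < n → Dseq α k (n - k) ⊆ Dseq α (k + 1) (n - (k + 1))) := by
  have hρ : ∀ k m, 1 ≤ k → k + m + 1 ≤ n → ρ k < ρ (k + m + 1) := by
    intro k m hk
    induction m with
    | zero => intro h; exact hmono k hk (by omega)
    | succ m ih =>
      intro h
      exact (ih (by omega)).trans (hmono (k + m + 1) (by omega) (by omega))
  have hD2 : ∀ k, 1 ≤ k → k ≤ n → Dens2 (α k) (ρ k) := fun k h1 h2 =>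
    (hasDens_iff (hlf k h1 h2) _).1 (hdens k h1 h2)
  have hL : ∀ k m, 1 ≤ k → k + m ≤ n → LocFin (Dseq α k m) := fun k m h1 h2 =>
    (hlf (k + m) (by omega) h2).mono (Dseq_sub α k m)
  have hadm : ∀ k m, 1 ≤ k → k + m + 1 ≤ n → Dens2 (Dseq α k m) (ρ k) →
      Admissible (Dseq α k m) (α (k + m + 1)) := fun k m h1 h2 hd =>
    adm_of_dens (hL k m h1 (by omega)) (hlf _ (by omega) h2)
      ((hdisj (k + m) (k + m + 1) (by omega) (by omega) h2).mono_left (Dseq_sub α k m))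
      (hρ k m h1 h2) hd (hD2 _ (by omega) h2)
  have hden : ∀ k m, 1 ≤ k → k + m ≤ n → Dens2 (Dseq α k m) (ρ k) := by
    intro k m hk
    induction m with
    | zero => intro h; exact hD2 k hk h
    | succ m ih =>
      intro h
      have hd := ih (by omega)
      exact dens_Dep (hadm k m hk h hd) (hρ k m hk h) hd (hD2 _ (by omega) h)
  have hnest : ∀ k m, 1 ≤ k → k + m + 1 ≤ n → Dseq α k (m + 1) ⊆ Dseq α (k + 1) m := by
    intro k m hk
    induction m with
    | zero => intro h; exact diff_subset
    | succ m ih =>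
      intro h
      have e : k + 1 + m + 1 = k + (m + 1) + 1 := by omega
      show Dep (Dseq α k (m + 1)) (α (k + (m + 1) + 1)) ⊆
        Dep (Dseq α (k + 1) m) (α (k + 1 + m + 1))
      rw [e]
      exact Dep_mono (hL (k + 1) m (by omega) (by omega)) (ih (by omega))
  refine ⟨fun k m h1 h2 => hadm k m h1 h2 (hden k m h1 (by omega)), fun k h1 h2 => ?_,
    fun k h1 h2 => ?_⟩
  · exact (hasDens_iff (hL k _ h1 (by omega)) _).2 (hden k _ h1 (by omega))
  · have e : n - k = (n - (k + 1)) + 1 := by omega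
    rw [e]
    exact hnest k _ h1 (by omega)
end
end

section
/- Let A and S be disjoint locally finite subsets of ℝ such that A has two-sided density λ and S has two-sided density ρ, with 0 ≤ λ < ρ. Then the pair (A,S) is admissible, the unused service times U(A,S) form a set of two-sided density ρ − λ, and the departure times D(A,S) form a set of two-sided density λ. -/
open Set Filter

noncomputable section

theorem aux_finIoc {B : Set ℝ} (hB : LocFin B) (a b : ℝ) : (B ∩ Set.Ioc a b).Finite :=
  (hB a b).subset (inter_subset_inter_right _ Ioc_subset_Icc_self)

theorem aux_add {B : Set ℝ} (hB : LocFin B) {a b c : ℝ} (h1 : a ≤ b) (h2 : b ≤ c) :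
    (B ∩ Set.Ioc a c).ncard = (B ∩ Set.Ioc a b).ncard + (B ∩ Set.Ioc b c).ncard := by
  rw [← Set.ncard_union_eq _ (aux_finIoc hB a b) (aux_finIoc hB b c), ← inter_union_distrib_left,
    Set.Ioc_union_Ioc_eq_Ioc h1 h2]
  rw [Set.disjoint_left]
  rintro x ⟨_, hx⟩ ⟨_, hy⟩
  exact absurd hx.2 (not_le.2 hy.1)

theorem aux_incr {A S : Set ℝ} (hA : LocFin A) (hS : LocFin S) {r s : ℝ} (h : r ≤ s) :
    Zfun A S s - Zfun A S r
      = ((A ∩ Set.Ioc r s).ncard : ℤ) - ((S ∩ Set.Ioc r s).ncard : ℤ) := by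
  unfold Zfun
  by_cases hr : 0 ≤ r
  · rw [if_pos hr, if_pos (hr.trans h), aux_add hA hr h, aux_add hS hr h]
    push_cast; ring
  · have hr' : r ≤ 0 := (not_le.1 hr).le
    by_cases hs : 0 ≤ s
    · rw [if_neg hr, if_pos hs, aux_add hA hr' hs, aux_add hS hr' hs]
      push_cast; ring
    · have hs' : s ≤ 0 := (not_le.1 hs).le
      rw [if_neg hr, if_neg hs, aux_add hA h hs', aux_add hS h hs']
      push_cast; ring

/-- no points just to the right -/
theorem aux_right {B : Set ℝ} (hB : LocFin B) (t : ℝ) :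
    ∃ e > t, ∀ x ∈ B, t < x → e < x := by
  have hf := aux_finIoc hB t (t + 1)
  rcases (B ∩ Set.Ioc t (t+1)).eq_empty_or_nonempty with h | h
  · refine ⟨t + 1/2, by linarith, fun x hx htx => ?_⟩
    by_contra hc
    have : x ∈ B ∩ Set.Ioc t (t+1) := ⟨hx, htx, by linarith⟩
    simp [h] at this
  · obtain ⟨m, hm, hmin⟩ := Set.exists_min_image _ id hf h
    refine ⟨(t + m)/2, by linarith [hm.2.1], fun x hx htx => ?_⟩
    have h1 := hm.2.1
    by_cases hx1 : x ≤ t + 1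
    · have := hmin x ⟨hx, htx, hx1⟩
      simp at this; linarith
    · linarith [hm.2.2]

theorem aux_left {B : Set ℝ} (hB : LocFin B) (t : ℝ) :
    ∃ e < t, ∀ x ∈ B, x < t → x ≤ e := by
  have hf : (B ∩ Set.Ico (t-1) t).Finite :=
    (hB (t-1) t).subset (inter_subset_inter_right _ Ico_subset_Icc_self)
  rcases (B ∩ Set.Ico (t-1) t).eq_empty_or_nonempty with h | h
  · refine ⟨t - 1, by linarith, fun x hx htx => ?_⟩
    by_contra hc
    have : x ∈ B ∩ Set.Ico (t-1) t := ⟨hx, by linarith, htx⟩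
    simp [h] at this
  · obtain ⟨m, hm, hmax⟩ := Set.exists_max_image _ id hf h
    refine ⟨m, hm.2.2, fun x hx htx => ?_⟩
    by_cases hx1 : t - 1 ≤ x
    · simpa using hmax x ⟨hx, hx1, htx⟩
    · linarith [hm.2.1]

theorem aux_first {A S : Set ℝ} (hA : LocFin A) (hS : LocFin S)
    (hbot : Tendsto (Zfun A S) atBot atTop) (k : ℤ) (s : ℝ) (hs : Zfun A S s ≤ k) :
    ∃ t ≤ s, t ∈ Unused A S ∧ Zfun A S t = k := by
  obtain ⟨T, hT⟩ := (hbot.eventually (eventually_gt_atTop k)).exists_forall_of_atBot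
  set E : Set ℝ := {t | Zfun A S t ≤ k} with hE
  have hbdd : BddBelow E := ⟨T, fun t ht => by
    by_contra hc
    exact absurd (hT t (not_le.1 hc).le) (not_lt.2 ht)⟩
  have hne : E.Nonempty := ⟨s, hs⟩
  set t := sInf E with ht
  have hts : t ≤ s := csInf_le hbdd hs
  have hlt : ∀ x < t, k < Zfun A S x := fun x hx => by
    by_contra hc
    exact absurd (csInf_le hbdd (show x ∈ E from not_lt.1 hc)) (not_le.2 hx)
  have hzt : Zfun A S t ≤ k := by
    obtain ⟨e1, he1, h1⟩ := aux_right hA t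
    obtain ⟨e2, he2, h2⟩ := aux_right hS t
    obtain ⟨x, hxE, hx⟩ := exists_lt_of_csInf_lt hne (show sInf E < min e1 e2 from lt_min he1 he2)
    have htx : t ≤ x := csInf_le hbdd hxE
    have hi := aux_incr hA hS htx
    have ea : A ∩ Set.Ioc t x = ∅ := by
      ext y; simp only [mem_inter_iff, mem_Ioc, mem_empty_iff_false, iff_false]
      rintro ⟨hy, hy1, hy2⟩
      have := h1 y hy hy1
      linarith [lt_min_iff.1 hx]
    have es : S ∩ Set.Ioc t x = ∅ := by
      ext y; simp only [mem_inter_iff, mem_Ioc, mem_empty_iff_false, iff_false]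
      rintro ⟨hy, hy1, hy2⟩
      have := h2 y hy hy1
      linarith [(lt_min_iff.1 hx).2]
    rw [ea, es] at hi
    simp at hi
    have : Zfun A S x ≤ k := hxE
    omega
  obtain ⟨e, he, h2⟩ := aux_left hS t
  have hi := aux_incr hA hS he.le
  have hk := hlt e he
  have hsub : S ∩ Set.Ioc e t ⊆ {t} := by
    rintro y ⟨hy, hy1, hy2⟩
    by_contra hc
    exact absurd (h2 y hy (lt_of_le_of_ne hy2 hc)) (not_le.2 hy1)
  have hcard : (S ∩ Set.Ioc e t).ncard ≤ 1 := by
    simpa using Set.ncard_le_ncard hsub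
  have htS : t ∈ S := by
    by_contra hc
    have : S ∩ Set.Ioc e t = ∅ := by
      ext y; simp only [mem_empty_iff_false, iff_false]
      intro hy
      have h3 : y = t := hsub hy
      exact hc (h3 ▸ hy.1)
    rw [this] at hi
    simp at hi
    omega
  refine ⟨t, hts, ⟨htS, fun x hx => lt_of_le_of_lt hzt (hlt x hx)⟩, by omega⟩

def auxM (A S : Set ℝ) (r : ℝ) : ℤ := sInf (Zfun A S '' Set.Iic r)

theorem aux_M {A S : Set ℝ} (hA : LocFin A) (hS : LocFin S)
    (hbot : Tendsto (Zfun A S) atBot atTop) (r : ℝ) :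
    (∃ t ≤ r, Zfun A S t = auxM A S r) ∧ ∀ t ≤ r, auxM A S r ≤ Zfun A S t := by
  have hb : BddBelow (Zfun A S '' Set.Iic r) := by
    obtain ⟨T, hT⟩ := (hbot.eventually (eventually_gt_atTop 0)).exists_forall_of_atBot
    refine ⟨min 0 (Zfun A S T - (S ∩ Set.Ioc T r).ncard), ?_⟩
    rintro _ ⟨x, hx, rfl⟩
    by_cases h : x ≤ T
    · exact (min_le_left _ _).trans (hT x h).le
    · refine (min_le_right _ _).trans ?_
      have h' := (not_le.1 h).le
      have hi := aux_incr hA hS h'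
      have : (S ∩ Set.Ioc T x).ncard ≤ (S ∩ Set.Ioc T r).ncard :=
        Set.ncard_le_ncard (inter_subset_inter_right _ (Ioc_subset_Ioc_right hx))
          (aux_finIoc hS T r)
      omega
  have hn : (Zfun A S '' Set.Iic r).Nonempty := ⟨_, r, mem_Iic.2 le_rfl, rfl⟩
  refine ⟨?_, fun t ht => csInf_le hb ⟨t, ht, rfl⟩⟩
  obtain ⟨t, ht, h⟩ := Int.csInf_mem hn hb
  exact ⟨t, ht, h⟩

theorem aux_count {A S : Set ℝ} (hA : LocFin A) (hS : LocFin S)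
    (hbot : Tendsto (Zfun A S) atBot atTop) {r s : ℝ} (h : r ≤ s) :
    ((Unused A S ∩ Set.Ioc r s).ncard : ℤ) = auxM A S r - auxM A S s := by
  obtain ⟨⟨tr, htr, hr1⟩, hr2⟩ := aux_M hA hS hbot r
  obtain ⟨⟨ts, hts, hs1⟩, hs2⟩ := aux_M hA hS hbot s
  have hinj : Set.InjOn (Zfun A S) (Unused A S ∩ Set.Ioc r s) := by
    intro x hx y hy hxy
    rcases lt_trichotomy x y with hl | hl | hl
    · have := hy.1.2 x hl; omega
    · exact hl
    · have := hx.1.2 y hl; omega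
  have himg : Zfun A S '' (Unused A S ∩ Set.Ioc r s) = Set.Ico (auxM A S s) (auxM A S r) := by
    ext k
    constructor
    · rintro ⟨u, ⟨hu, hu1, hu2⟩, rfl⟩
      refine ⟨hs2 u hu2, ?_⟩
      rw [← hr1]
      exact hu.2 tr (lt_of_le_of_lt htr hu1)
    · rintro ⟨hk1, hk2⟩
      obtain ⟨t, ht, htU, htk⟩ := aux_first hA hS hbot k ts (by omega)
      refine ⟨t, ⟨htU, ?_, ht.trans hts⟩, htk⟩
      by_contra hc
      have := hr2 t (not_lt.1 hc)
      omega
  have hle : auxM A S s ≤ auxM A S r := by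
    rw [← hr1]; exact hs2 tr (htr.trans h)
  rw [← Set.InjOn.ncard_image hinj, himg, ← Finset.coe_Ico, Set.ncard_coe_finset, Int.card_Ico]
  omega

theorem aux_Icc {B : Set ℝ} (hB : LocFin B) (a b : ℝ) :
    |((B ∩ Set.Icc a b).ncard : ℝ) - (B ∩ Set.Ioc a b).ncard| ≤ 1 := by
  have h1 : (B ∩ Set.Ioc a b).ncard ≤ (B ∩ Set.Icc a b).ncard :=
    Set.ncard_le_ncard (inter_subset_inter_right _ Ioc_subset_Icc_self) (hB a b)
  have h2 : (B ∩ Set.Icc a b).ncard ≤ (B ∩ Set.Ioc a b).ncard + 1 := by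
    refine (Set.ncard_le_ncard (t := insert a (B ∩ Set.Ioc a b)) ?_
      ((aux_finIoc hB a b).insert a)).trans (Set.ncard_insert_le _ _)
    rintro x ⟨hx, hx1, hx2⟩
    rcases hx1.eq_or_lt with h | h
    · left; exact h.symm
    · right; exact ⟨hx, h, hx2⟩
  have h1' : ((B ∩ Set.Ioc a b).ncard : ℝ) ≤ (B ∩ Set.Icc a b).ncard := by exact_mod_cast h1
  have h2' : ((B ∩ Set.Icc a b).ncard : ℝ) ≤ (B ∩ Set.Ioc a b).ncard + 1 := by exact_mod_cast h2
  rw [abs_le]; constructor <;> linarith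

theorem aux_close {f g : ℝ → ℝ} {C l : ℝ} (h : ∀ s, |f s - g s| ≤ C)
    (hf : Tendsto (fun s => f s / s) atTop (nhds l)) :
    Tendsto (fun s => g s / s) atTop (nhds l) := by
  have h0 : Tendsto (fun s : ℝ => (f s - g s) / s) atTop (nhds 0) := by
    have hC : Tendsto (fun s : ℝ => C / s) atTop (nhds 0) := tendsto_const_nhds.div_atTop tendsto_id
    refine squeeze_zero_norm' ?_ hC
    filter_upwards [eventually_gt_atTop 0] with s hs
    rw [Real.norm_eq_abs, abs_div, abs_of_pos hs]
    exact div_le_div_of_nonneg_right (h s) hs.le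
  have := hf.sub h0
  rw [sub_zero] at this
  refine this.congr fun s => ?_
  rw [← sub_div]; congr 1; ring

theorem aux_dens {B : Set ℝ} (hB : LocFin B) (l : ℝ) :
    HasDens B l ↔ 
  Tendsto (fun s : ℝ => ((B ∩ Set.Ioc 0 s).ncard : ℝ) / s) atTop (nhds l) ∧
  Tendsto (fun s : ℝ => ((B ∩ Set.Ioc (-s) 0).ncard : ℝ) / s) atTop (nhds l) := by
  constructor
  · rintro ⟨h1, h2⟩
    exact ⟨aux_close (fun s => aux_Icc hB 0 s) h1, aux_close (fun s => aux_Icc hB (-s) 0) h2⟩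
  · rintro ⟨h1, h2⟩
    exact ⟨aux_close (fun s => by rw [abs_sub_comm]; exact aux_Icc hB 0 s) h1,
      aux_close (fun s => by rw [abs_sub_comm]; exact aux_Icc hB (-s) 0) h2⟩

theorem aux_Mtop {A S : Set ℝ} (hA : LocFin A) (hS : LocFin S)
    (hbot : Tendsto (Zfun A S) atBot atTop) {c : ℝ} (hc : 0 < c)
    (hz : Tendsto (fun s : ℝ => (Zfun A S s : ℝ) / s) atTop (nhds (-c))) :
    Tendsto (fun s : ℝ => (auxM A S s : ℝ) / s) atTop (nhds (-c)) := by
  rw [tendsto_order] at hz ⊢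
  obtain ⟨hz1, hz2⟩ := hz
  have hle : ∀ s, (auxM A S s : ℝ) ≤ Zfun A S s := fun s => by
    exact_mod_cast (aux_M hA hS hbot s).2 s le_rfl
  constructor
  · intro a ha
    obtain ⟨T, hT⟩ := ((hz1 a ha).and (eventually_gt_atTop 0)).exists_forall_of_atTop
    have hev : ∀ᶠ s : ℝ in atTop, a * s < auxM A S T :=
      (tendsto_id.const_mul_atTop_of_neg (by linarith : a < 0)).eventually (eventually_lt_atBot _)
    filter_upwards [hev, eventually_gt_atTop 0, eventually_ge_atTop T] with s h1 h2 h3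
    rw [lt_div_iff₀ h2]
    obtain ⟨t, ht, he⟩ := (aux_M hA hS hbot s).1
    rw [← he]
    by_cases htT : t ≤ T
    · have : (auxM A S T : ℝ) ≤ Zfun A S t := by exact_mod_cast (aux_M hA hS hbot T).2 t htT
      linarith
    · obtain ⟨h4, h5⟩ := hT t (not_le.1 htT).le
      rw [lt_div_iff₀ h5] at h4
      have : a * s ≤ a * t := mul_le_mul_of_nonpos_left ht (by linarith)
      linarith
  · intro a ha
    filter_upwards [hz2 a ha, eventually_gt_atTop 0] with s h1 h2
    exact lt_of_le_of_lt (div_le_div_of_nonneg_right (hle s) h2.le) h1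

theorem aux_Mbot {A S : Set ℝ} (hA : LocFin A) (hS : LocFin S)
    (hbot : Tendsto (Zfun A S) atBot atTop) {c : ℝ} (hc : 0 < c)
    (hz : Tendsto (fun s : ℝ => (Zfun A S (-s) : ℝ) / s) atTop (nhds c)) :
    Tendsto (fun s : ℝ => (auxM A S (-s) : ℝ) / s) atTop (nhds c) := by
  rw [tendsto_order] at hz ⊢
  obtain ⟨hz1, hz2⟩ := hz
  have hle : ∀ s, (auxM A S s : ℝ) ≤ Zfun A S s := fun s => by
    exact_mod_cast (aux_M hA hS hbot s).2 s le_rfl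
  constructor
  · intro a ha
    obtain ⟨b, hb1, hb2⟩ := exists_between (max_lt ha hc)
    obtain ⟨hab, hb0⟩ := max_lt_iff.1 hb1
    obtain ⟨T, hT⟩ := ((hz1 b hb2).and (eventually_gt_atTop 0)).exists_forall_of_atTop
    filter_upwards [eventually_gt_atTop 0, eventually_ge_atTop T] with s h2 h3
    refine hab.trans_le ?_
    rw [le_div_iff₀ h2]
    obtain ⟨t, ht, he⟩ := (aux_M hA hS hbot (-s)).1
    rw [← he]
    obtain ⟨h4, h5⟩ := hT (-t) (by linarith)
    rw [lt_div_iff₀ h5, neg_neg] at h4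
    have : b * s ≤ b * (-t) := mul_le_mul_of_nonneg_left (by linarith) hb0.le
    linarith
  · intro a ha
    filter_upwards [hz2 a ha, eventually_gt_atTop 0] with s h1 h2
    exact lt_of_le_of_lt (div_le_div_of_nonneg_right (hle (-s)) h2.le) h1

/-- If `A` and `S` are disjoint locally finite subsets of `ℝ` with two-sided
densities `λ` and `ρ`, `0 ≤ λ < ρ`, then `(A,S)` is admissible, `U(A,S)` has two-sided
density `ρ - λ` and `D(A,S)` has two-sided density `λ`. -/
theorem admissible_unused_departures_density (A S : Set ℝ) (lam rho : ℝ)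
    (hA : LocFin A) (hS : LocFin S) (hd : Disjoint A S)
    (hdA : HasDens A lam) (hdS : HasDens S rho) (h0 : 0 ≤ lam) (hlr : lam < rho) :
    Admissible A S ∧ HasDens (Unused A S) (rho - lam) ∧ HasDens (Dep A S) lam := by
  have hdA' := (aux_dens hA lam).1 hdA
  have hdS' := (aux_dens hS rho).1 hdS
  have hc : 0 < rho - lam := by linarith
  have hz1 : Tendsto (fun s : ℝ => (Zfun A S s : ℝ) / s) atTop (nhds (-(rho - lam))) := by
    have := hdA'.1.sub hdS'.1
    rw [neg_sub]
    refine this.congr' ?_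
    filter_upwards [eventually_gt_atTop 0] with s hs
    rw [Zfun, if_pos hs.le]
    push_cast; ring
  have hz2 : Tendsto (fun s : ℝ => (Zfun A S (-s) : ℝ) / s) atTop (nhds (rho - lam)) := by
    have := hdS'.2.sub hdA'.2
    refine this.congr' ?_
    filter_upwards [eventually_gt_atTop 0] with s hs
    rw [Zfun, if_neg (by linarith)]
    push_cast; ring
  have htop : Tendsto (Zfun A S) atTop atBot := by
    rw [← tendsto_intCast_atBot_iff (R := ℝ)]
    refine (hz1.neg_mul_atTop (by linarith) tendsto_id).congr' ?_
    filter_upwards [eventually_gt_atTop 0] with s hs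
    simp only [id]
    field_simp
  have hbot : Tendsto (Zfun A S) atBot atTop := by
    rw [← tendsto_intCast_atTop_iff (R := ℝ)]
    have h : Tendsto (fun s : ℝ => (Zfun A S (-s) : ℝ)) atTop atTop := by
      refine (hz2.pos_mul_atTop hc tendsto_id).congr' ?_
      filter_upwards [eventually_gt_atTop 0] with s hs
      simp only [id]
      field_simp
    simpa [Function.comp_def] using h.comp tendsto_neg_atBot_atTop
  have hUS : Unused A S ⊆ S := fun x hx => hx.1
  have hU : LocFin (Unused A S) := fun a b =>
    (hS a b).subset (inter_subset_inter_left _ hUS)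
  have hdU : HasDens (Unused A S) (rho - lam) := by
    rw [aux_dens hU]
    have hC : Tendsto (fun s : ℝ => (auxM A S 0 : ℝ) / s) atTop (nhds 0) :=
      tendsto_const_nhds.div_atTop tendsto_id
    constructor
    · have := hC.sub (aux_Mtop hA hS hbot hc hz1)
      rw [zero_sub, neg_neg] at this
      refine this.congr' ?_
      filter_upwards [eventually_gt_atTop 0] with s hs
      have h := aux_count hA hS hbot hs.le
      have h' : ((Unused A S ∩ Set.Ioc 0 s).ncard : ℝ) = auxM A S 0 - auxM A S s := by
        exact_mod_cast h
      rw [h']; ring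
    · have := (aux_Mbot hA hS hbot hc hz2).sub hC
      rw [sub_zero] at this
      refine this.congr' ?_
      filter_upwards [eventually_gt_atTop 0] with s hs
      have h := aux_count hA hS hbot (show -s ≤ 0 by linarith)
      have h' : ((Unused A S ∩ Set.Ioc (-s) 0).ncard : ℝ) = auxM A S (-s) - auxM A S 0 := by
        exact_mod_cast h
      rw [h']; ring
  have hcard : ∀ a b : ℝ, ((Dep A S ∩ Set.Icc a b).ncard : ℝ)
      = (S ∩ Set.Icc a b).ncard - (Unused A S ∩ Set.Icc a b).ncard := by
    intro a b
    have h : S ∩ Set.Icc a b = (Dep A S ∩ Set.Icc a b) ∪ (Unused A S ∩ Set.Icc a b) := by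
      rw [← union_inter_distrib_right, Dep, Set.sdiff_union_of_subset hUS]
    rw [h, Set.ncard_union_eq _ ((hS a b).subset (inter_subset_inter_left _ (fun x hx => hx.1)))
      (hU a b)]
    · push_cast; ring
    · rw [Set.disjoint_left]
      rintro x ⟨hx, _⟩ ⟨hy, _⟩
      exact hx.2 hy
  refine ⟨⟨hA, hS, hd, htop, hbot⟩, hdU, ?_, ?_⟩
  · have := hdS.1.sub hdU.1
    rw [sub_sub_cancel] at this
    refine this.congr fun s => ?_
    rw [hcard]; ring
  · have := hdS.2.sub hdU.2
    rw [sub_sub_cancel] at this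
    refine this.congr fun s => ?_
    rw [hcard]; ring
end
end

section
/- Let η ⊆ η' be locally finite subsets of ℝ and let x ∈ ℝ be such that η ∩ (−∞, x) is nonempty (hence so is η' ∩ (−∞, x)). Then the Hammersley jump at x preserves the inclusion: h_x(η) ⊆ h_x(η'). -/
open Set Filter

noncomputable section

/-- `u(η,x)`: the nearest particle of `η` strictly to the left of `x`
(the maximum of `η ∩ (-∞,x)`, which is attained when `η` is locally finite and
`η ∩ (-∞,x)` is nonempty, and then equals this supremum). -/
def nearLeft (η : Set ℝ) (x : ℝ) : ℝ := sSup (η ∩ Set.Iio x)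

/-- The Hammersley jump map `h_x(η) = (η \ {u(η,x)}) ∪ {x}`. -/
def hamm (η : Set ℝ) (x : ℝ) : Set ℝ := (η \ {nearLeft η x}) ∪ {x}

/-- If `η ⊆ η'` are locally finite subsets of `ℝ` and `η ∩ (-∞,x)` is nonempty
(hence so is `η' ∩ (-∞,x)`), then the Hammersley jump at `x` preserves the inclusion:
`h_x(η) ⊆ h_x(η')`. -/
theorem hamm_mono (η η' : Set ℝ) (hη : LocFin η) (hη' : LocFin η') (hsub : η ⊆ η')
    (x : ℝ) (hne : (η ∩ Set.Iio x).Nonempty) :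
    hamm η x ⊆ hamm η' x := by
  rintro y (⟨hy, hyu⟩ | hyx)
  · by_cases hyx : y = x
    · exact Or.inr hyx
    refine Or.inl ⟨hsub hy, fun h => hyu ?_⟩
    have h' : y = sSup (η' ∩ Set.Iio x) := h
    have hs : η ∩ Set.Iio x ⊆ η' ∩ Set.Iio x := Set.inter_subset_inter_left _ hsub
    have hbd : ∀ s : Set ℝ, BddAbove (s ∩ Set.Iio x) := fun s => ⟨x, fun z hz => le_of_lt hz.2⟩
    have h1 : y ≤ x := h' ▸ csSup_le (hne.mono hs) (fun z hz => le_of_lt hz.2)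
    have h2 : y ≤ sSup (η ∩ Set.Iio x) := le_csSup (hbd η) ⟨hy, lt_of_le_of_ne h1 hyx⟩
    have h3 : sSup (η ∩ Set.Iio x) ≤ y := h'.symm ▸ csSup_le_csSup (hbd η') hne hs
    exact le_antisymm h2 h3
  · exact Or.inr hyx
end
end

section
/- Let η ⊆ η' be locally finite subsets of ℝ and let x₁, …, x_m ∈ ℝ be such that for each i = 1, …, m the configuration h_{x_{i−1}}(⋯h_{x₁}(η)⋯) obtained from η after the first i−1 jumps has a particle strictly to the left of x_i (hence so does the configuration obtained from η'). Then the inclusion is maintained after all jumps: h_{x_m}(⋯h_{x₁}(η)⋯) ⊆ h_{x_m}(⋯h_{x₁}(η')⋯). -/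
open Set Filter

noncomputable section

/-- `hammIter η [x₁,…,x_m] = h_{x_m}(⋯ h_{x₁}(η) ⋯)`, the configuration obtained from `η`
after successive Hammersley jumps at `x₁,…,x_m`. -/
def hammIter (η : Set ℝ) (l : List ℝ) : Set ℝ := l.foldl hamm η

theorem hamm_mono_aux (η η' : Set ℝ) (hsub : η ⊆ η') (x : ℝ)
    (hne : (η ∩ Set.Iio x).Nonempty) : hamm η x ⊆ hamm η' x := by
  rintro z (⟨hz, hzn⟩ | hz)
  · by_cases hzx : z = x
    · exact Or.inr hzx
    refine Or.inl ⟨hsub hz, fun h => hzn ?_⟩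
    have h : z = sSup (η' ∩ Set.Iio x) := h
    have hsub' : η ∩ Set.Iio x ⊆ η' ∩ Set.Iio x := Set.inter_subset_inter_left _ hsub
    have bdd' : BddAbove (η' ∩ Set.Iio x) := ⟨x, fun y hy => le_of_lt hy.2⟩
    have hle : z ≤ x := by
      rw [h]
      exact csSup_le (hne.mono hsub') fun y hy => le_of_lt hy.2
    have hlt : z < x := lt_of_le_of_ne hle hzx
    have h1 : z ≤ sSup (η ∩ Set.Iio x) := le_csSup (bdd'.mono hsub') ⟨hz, hlt⟩
    have h2 : sSup (η ∩ Set.Iio x) ≤ sSup (η' ∩ Set.Iio x) := csSup_le_csSup bdd' hne hsub'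
    show z = sSup (η ∩ Set.Iio x)
    linarith
  · exact Or.inr hz

theorem hammIter_mono_aux (l : List ℝ) : ∀ (η η' : Set ℝ), η ⊆ η' →
    (∀ (pre : List ℝ) (y : ℝ) (suf : List ℝ), l = pre ++ y :: suf →
      (hammIter η pre ∩ Set.Iio y).Nonempty) →
    hammIter η l ⊆ hammIter η' l := by
  induction l with
  | nil => intro η η' h _; exact h
  | cons x l ih =>
    intro η η' h hne
    refine ih (hamm η x) (hamm η' x) (hamm_mono_aux η η' h x (hne [] x l rfl)) ?_
    intro pre y suf hl
    exact hne (x :: pre) y suf (by rw [hl]; rfl)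

/-- Let `η ⊆ η'` be locally finite and let `x₁,…,x_m` be such that for each `i`
the configuration obtained from `η` after the first `i-1` jumps has a particle strictly to
the left of `x_i` (hence so does the one obtained from `η'`). Then the inclusion is
maintained after all jumps. -/
theorem hammIter_mono (η η' : Set ℝ) (hη : LocFin η) (hη' : LocFin η') (hsub : η ⊆ η')
    (l : List ℝ)
    (hne : ∀ (pre : List ℝ) (y : ℝ) (suf : List ℝ), l = pre ++ y :: suf →
      (hammIter η pre ∩ Set.Iio y).Nonempty) :
    hammIter η l ⊆ hammIter η' l := by
  exact hammIter_mono_aux l η η' hsub hne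
end
end

section
/- Let α = (α¹, …, αⁿ) be an n-tuple of locally finite subsets of ℝ and x ∈ ℝ. Suppose the positions x^{n+1} = x and x^k = max(α^k ∩ (−∞, x^{k+1})) for k = n, …, 1 all exist, and that x^{k+1} ∉ α^k for each k = 1, …, n. Then the multi-line jump J(α,x), defined line-wise by J(α,x)^k = (α^k \ {x^k}) ∪ {x^{k+1}}, satisfies the inverse identity J*(J(α,x), x¹) = α, where the reverse multi-line jump J*(β,y) is defined by y⁰ = y, y^k = min(β^k ∩ (y^{k−1}, ∞)) for k = 1, …, n, and J*(β,y)^k = (β^k \ {y^k}) ∪ {y^{k−1}}. Symmetrically, if for y ∈ ℝ the positions y⁰ = y and y^k = min(α^k ∩ (y^{k−1}, ∞)) for k = 1, …, n all exist and y^{k−1} ∉ α^k for each k = 1, …, n, then J(J*(α,y), yⁿ) = α. -/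
open Set Filter

noncomputable section

/-- the multi-line jump `J(α,x)` (given line-wise by
`J(α,x)^k = (α^k \ {x^k}) ∪ {x^{k+1}}`, where `x^{n+1} = x` and
`x^k = max(α^k ∩ (-∞, x^{k+1}))`) and the reverse multi-line jump `J*(β,y)` (given by
`J*(β,y)^k = (β^k \ {y^k}) ∪ {y^{k-1}}`, where `y⁰ = y` and `y^k = min(β^k ∩ (y^{k-1},∞))`)
are inverse to each other: `J*(J(α,x), x¹) = α` and `J(J*(α,y), yⁿ) = α`,
under the stated existence and non-membership conditions.
Lines are indexed `1,…,n`; the jump positions `x^k`, `y^k` are encoded by functions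
`xs ys : ℕ → ℝ`, with maxima/minima expressed via `IsGreatest`/`IsLeast`. -/
theorem multiline_jump_inverse (n : ℕ) (hn : 1 ≤ n) (α : ℕ → Set ℝ)
    (hlf : ∀ k, 1 ≤ k → k ≤ n → LocFin (α k)) :
    -- forward then reverse:  J*(J(α,x), x¹) = α
    (∀ (x : ℝ) (xs : ℕ → ℝ), xs (n + 1) = x →
      (∀ k, 1 ≤ k → k ≤ n → IsGreatest (α k ∩ Set.Iio (xs (k + 1))) (xs k)) →
      (∀ k, 1 ≤ k → k ≤ n → xs (k + 1) ∉ α k) →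
      ∃ ys : ℕ → ℝ, ys 0 = xs 1 ∧
        (∀ k, 1 ≤ k → k ≤ n →
          IsLeast (((α k \ {xs k}) ∪ {xs (k + 1)}) ∩ Set.Ioi (ys (k - 1))) (ys k)) ∧
        (∀ k, 1 ≤ k → k ≤ n →
          ((((α k \ {xs k}) ∪ {xs (k + 1)}) \ {ys k}) ∪ {ys (k - 1)}) = α k)) ∧
    -- reverse then forward:  J(J*(α,y), yⁿ) = α
    (∀ (y : ℝ) (ys : ℕ → ℝ), ys 0 = y →
      (∀ k, 1 ≤ k → k ≤ n → IsLeast (α k ∩ Set.Ioi (ys (k - 1))) (ys k)) →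
      (∀ k, 1 ≤ k → k ≤ n → ys (k - 1) ∉ α k) →
      ∃ xs : ℕ → ℝ, xs (n + 1) = ys n ∧
        (∀ k, 1 ≤ k → k ≤ n →
          IsGreatest (((α k \ {ys k}) ∪ {ys (k - 1)}) ∩ Set.Iio (xs (k + 1))) (xs k)) ∧
        (∀ k, 1 ≤ k → k ≤ n →
          ((((α k \ {ys k}) ∪ {ys (k - 1)}) \ {xs k}) ∪ {xs (k + 1)}) = α k)) := by
  constructor
  · rintro x xs - h1 h2
    refine ⟨fun k => xs (k + 1), rfl, ?_, ?_⟩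
    · intro k hk hkn
      obtain ⟨⟨ha, hb⟩, hc⟩ := h1 k hk hkn
      have e : k - 1 + 1 = k := by omega
      simp only [e]
      refine ⟨⟨Or.inr rfl, hb⟩, ?_⟩
      rintro z ⟨⟨hz, -⟩ | hz, hz2⟩
      · by_contra hlt
        exact absurd (hc ⟨hz, not_le.mp hlt⟩) (not_le.mpr hz2)
      · exact le_of_eq hz.symm
    · intro k hk hkn
      obtain ⟨⟨ha, hb⟩, hc⟩ := h1 k hk hkn
      have h3 := h2 k hk hkn
      have e : k - 1 + 1 = k := by omega
      simp only [e]
      ext z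
      simp only [mem_union, mem_diff, mem_singleton_iff]
      grind
  · rintro y ys - h1 h2
    refine ⟨fun k => ys (k - 1), rfl, ?_, ?_⟩
    · intro k hk hkn
      obtain ⟨⟨ha, hb⟩, hc⟩ := h1 k hk hkn
      simp only [Nat.add_sub_cancel]
      refine ⟨⟨Or.inr rfl, hb⟩, ?_⟩
      rintro z ⟨⟨hz, -⟩ | hz, hz2⟩
      · by_contra hlt
        exact absurd (hc ⟨hz, not_le.mp hlt⟩) (not_le.mpr hz2)
      · exact le_of_eq hz
    · intro k hk hkn
      obtain ⟨⟨ha, hb⟩, hc⟩ := h1 k hk hkn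
      have h3 := h2 k hk hkn
      simp only [Nat.add_sub_cancel]
      ext z
      simp only [mem_union, mem_diff, mem_singleton_iff]
      grind
end
end

section
/- Let N > 0 and let A, S be disjoint locally finite subsets of ℝ that are periodic with period N (i.e. A + N = A and S + N = S) and satisfy |S ∩ [0,N)| > |A ∩ [0,N)|. Then the pair (A,S) is admissible, the queue length Q_r = Z_r − min_{r' ≤ r} Z_{r'} is well defined and periodic with period N, Q_r = 0 for every r ∈ U(A,S), and Q is the minimal solution of the queue equation: every right-continuous function Q' : ℝ → ℤ_{≥0} that is locally constant on ℝ \ (A ∪ S) and satisfies Q'_r = Q'_{r−} + 1 for r ∈ A and Q'_r = Q'_{r−} − 1{Q'_{r−} > 0} for r ∈ S, satisfies Q'_r ≥ Q_r for all r ∈ ℝ. -/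
open Set Filter Classical

noncomputable section

lemma cnt_add {B : Set ℝ} (hB : LocFin B) {a b c : ℝ} (h1 : a ≤ b) (h2 : b ≤ c) :
    (B ∩ Ioc a c).ncard = (B ∩ Ioc a b).ncard + (B ∩ Ioc b c).ncard := by
  have hf : ∀ x y, (B ∩ Ioc x y).Finite := fun x y =>
    (hB x y).subset (inter_subset_inter_right _ Ioc_subset_Icc_self)
  rw [← Set.ncard_union_eq _ (hf _ _) (hf _ _), ← inter_union_distrib_left,
    Ioc_union_Ioc_eq_Ioc h1 h2]
  rw [Set.disjoint_left]
  rintro x ⟨_, hx⟩ ⟨_, hy⟩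
  exact absurd hx.2 (not_le.2 hy.1)

lemma Z_sub {A S : Set ℝ} (hA : LocFin A) (hS : LocFin S) {r s : ℝ} (h : r ≤ s) :
    Zfun A S s - Zfun A S r = ((A ∩ Ioc r s).ncard : ℤ) - ((S ∩ Ioc r s).ncard : ℤ) := by
  unfold Zfun
  by_cases h0 : 0 ≤ r
  · have h1 : 0 ≤ s := h0.trans h
    rw [if_pos h0, if_pos h1, cnt_add hA h0 h, cnt_add hS h0 h]
    push_cast; ring
  · rw [if_neg h0]
    have h0' : r ≤ 0 := (not_le.1 h0).le
    by_cases h1 : 0 ≤ s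
    · rw [if_pos h1, cnt_add hA h0' h1, cnt_add hS h0' h1]
      push_cast; ring
    · rw [if_neg h1]
      have h1' : s ≤ 0 := (not_le.1 h1).le
      rw [cnt_add hA h h1', cnt_add hS h h1']
      push_cast; ring

lemma cnt_shift {B : Set ℝ} {N : ℝ} (hp : ∀ r : ℝ, r ∈ B ↔ r + N ∈ B) (a b : ℝ) :
    (B ∩ Ioc (a + N) (b + N)).ncard = (B ∩ Ioc a b).ncard := by
  have : B ∩ Ioc (a + N) (b + N) = (fun x => x + N) '' (B ∩ Ioc a b) := by
    ext x
    constructor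
    · rintro ⟨hx, h1, h2⟩
      refine ⟨x - N, ⟨(hp _).2 (by simpa using hx), ?_, ?_⟩, by simp⟩ <;> linarith
    · rintro ⟨y, ⟨hy, h1, h2⟩, rfl⟩
      refine ⟨(hp _).1 hy, ?_, ?_⟩ <;> simpa
  rw [this, Set.ncard_image_of_injective _ (add_left_injective N)]

lemma cnt_Ico {B : Set ℝ} (hB : LocFin B) {N : ℝ} (hN : 0 < N)
    (hp : ∀ r : ℝ, r ∈ B ↔ r + N ∈ B) :
    (B ∩ Ico 0 N).ncard = (B ∩ Ioc 0 N).ncard := by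
  have h0 : (0:ℝ) ∈ B ↔ N ∈ B := by simpa using hp 0
  have hf : (B ∩ Ioo 0 N).Finite :=
    (hB 0 N).subset (inter_subset_inter_right _ Ioo_subset_Icc_self)
  rw [← Ioo_insert_left hN, ← Ioo_insert_right hN]
  by_cases h : (0:ℝ) ∈ B
  · rw [inter_insert_of_mem h, inter_insert_of_mem (h0.1 h),
      ncard_insert_of_notMem (by simp) hf, ncard_insert_of_notMem (by simp) hf]
  · rw [inter_insert_of_notMem h, inter_insert_of_notMem (fun h' => h (h0.2 h'))]

lemma cnt_period {B : Set ℝ} (hB : LocFin B) {N : ℝ} (hN : 0 < N)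
    (hp : ∀ r : ℝ, r ∈ B ↔ r + N ∈ B) (r : ℝ) :
    (B ∩ Ioc r (r + N)).ncard = (B ∩ Ico 0 N).ncard := by
  have key : ∀ r s : ℝ, r ≤ s →
      (B ∩ Ioc r (r + N)).ncard = (B ∩ Ioc s (s + N)).ncard := by
    intro r s h
    have e1 := cnt_add hB (show r ≤ r + N by linarith) (show r + N ≤ s + N by linarith)
    have e2 := cnt_add hB h (show s ≤ s + N by linarith)
    have e3 := cnt_shift hp r s
    omega
  rw [cnt_Ico hB hN hp]
  rcases le_total r 0 with h | h
  · simpa using key r 0 h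
  · simpa using (key 0 r h).symm

lemma isolated {B : Set ℝ} (hB : LocFin B) (t : ℝ) :
    ∀ᶠ u in nhds t, u < t → B ∩ Ioc u t = B ∩ {t} := by
  have hf : ((B ∩ Icc (t-1) t) \ {t}).Finite := (hB _ _).subset sdiff_subset
  have ho := hf.isClosed.isOpen_compl.mem_nhds (show t ∈ _ by simp)
  obtain ⟨ε, hε, hb⟩ := Metric.mem_nhds_iff.1 ho
  filter_upwards [Metric.ball_mem_nhds t hε, Ioi_mem_nhds (show t - 1 < t by linarith)] with u hu hu1 hut
  rw [Metric.mem_ball, Real.dist_eq, abs_lt] at hu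
  simp only [mem_Ioi] at hu1
  ext x
  simp only [mem_inter_iff, mem_Ioc, mem_singleton_iff]
  constructor
  · rintro ⟨hx, h1, h2⟩
    refine ⟨hx, ?_⟩
    by_contra hne
    have : x ∈ Metric.ball t ε := by
      rw [Metric.mem_ball, Real.dist_eq, abs_lt]; constructor <;> linarith
    exact hb this ⟨⟨hx, by linarith, h2⟩, hne⟩
  · rintro ⟨hx, rfl⟩
    exact ⟨hx, hut, le_rfl⟩

lemma isolated_right {B : Set ℝ} (hB : LocFin B) (t : ℝ) :
    ∀ᶠ u in nhds t, t < u → B ∩ Ioc t u = ∅ := by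
  have hf : ((B ∩ Icc t (t+1)) \ {t}).Finite := (hB _ _).subset sdiff_subset
  have ho := hf.isClosed.isOpen_compl.mem_nhds (show t ∈ _ by simp)
  obtain ⟨ε, hε, hb⟩ := Metric.mem_nhds_iff.1 ho
  filter_upwards [Metric.ball_mem_nhds t hε, Iio_mem_nhds (show t < t + 1 by linarith)]
    with u hu hu1 hut
  rw [Metric.mem_ball, Real.dist_eq, abs_lt] at hu
  simp only [mem_Iio] at hu1
  rw [eq_empty_iff_forall_notMem]
  rintro x ⟨hx, h1, h2⟩
  have : x ∈ Metric.ball t ε := by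
    rw [Metric.mem_ball, Real.dist_eq, abs_lt]; constructor <;> linarith
  exact hb this ⟨⟨hx, h1.le, by linarith⟩, h1.ne'⟩

lemma mono_of_local {g : ℝ → ℤ} (hl : ∀ t, ∀ᶠ u in nhdsWithin t (Iio t), g u ≤ g t)
    (hr : ∀ t, ∀ᶠ u in nhdsWithin t (Ioi t), g t ≤ g u) {a b : ℝ} (hab : a ≤ b) :
    g a ≤ g b := by
  set T : Set ℝ := {t | t ∈ Icc a b ∧ ∀ u ∈ Icc a t, g a ≤ g u} with hT
  have haT : a ∈ T := ⟨⟨le_rfl, hab⟩, fun u hu => by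
    rw [le_antisymm hu.2 hu.1]⟩
  have hbd : BddAbove T := ⟨b, fun t ht => ht.1.2⟩
  set s := sSup T with hs
  have has : a ≤ s := le_csSup hbd haT
  have hsb : s ≤ b := csSup_le ⟨a, haT⟩ fun t ht => ht.1.2
  have hlt : ∀ u, a ≤ u → u < s → g a ≤ g u := by
    intro u hau hus
    obtain ⟨t, ht, hut⟩ := exists_lt_of_lt_csSup ⟨a, haT⟩ hus
    exact ht.2 u ⟨hau, hut.le⟩
  have hgs : g a ≤ g s := by
    rcases has.eq_or_lt with h | h
    · rw [← h]
    · obtain ⟨u, hu, hua, hus⟩ := ((hl s).and (Ioo_mem_nhdsLT h)).exists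
      exact (hlt u hua.le hus).trans hu
  rcases hsb.eq_or_lt with h | h
  · rwa [← h]
  · exfalso
    obtain ⟨c, hc, hcs⟩ := (mem_nhdsGT_iff_exists_Ioo_subset).1 (hr s)
    have hc' : s < c := hc
    obtain ⟨d, hd1, hd2⟩ := exists_between (lt_min hc' h)
    have hd3 := lt_min_iff.1 hd2
    have : d ∈ T := by
      refine ⟨⟨has.trans hd1.le, hd3.2.le⟩, fun u hu => ?_⟩
      rcases lt_trichotomy u s with h1 | h1 | h1
      · exact hlt u hu.1 h1
      · rw [h1]; exact hgs
      · exact hgs.trans (hcs ⟨h1, hu.2.trans_lt hd3.1⟩)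
    exact absurd (le_csSup hbd this) (not_le.2 hd1)

lemma Z_period {A S : Set ℝ} (hA : LocFin A) (hS : LocFin S) {N : ℝ} (hN : 0 < N)
    (hpA : ∀ r : ℝ, r ∈ A ↔ r + N ∈ A) (hpS : ∀ r : ℝ, r ∈ S ↔ r + N ∈ S) (r : ℝ) :
    Zfun A S (r + N) = Zfun A S r -
      (((S ∩ Ico 0 N).ncard : ℤ) - ((A ∩ Ico 0 N).ncard : ℤ)) := by
  have := Z_sub hA hS (show r ≤ r + N by linarith)
  rw [cnt_period hA hN hpA, cnt_period hS hN hpS] at this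
  linarith

lemma Z_floor {A S : Set ℝ} (hA : LocFin A) (hS : LocFin S) {N : ℝ} (hN : 0 < N) {k : ℤ}
    (hp : ∀ r, Zfun A S (r + N) = Zfun A S r - k) :
    ∃ M : ℤ, ∀ r, Zfun A S r ≤ M - ⌊r / N⌋ * k ∧ -M - ⌊r / N⌋ * k ≤ Zfun A S r := by
  refine ⟨((A ∩ Ioc 0 N).ncard : ℤ) + ((S ∩ Ioc 0 N).ncard : ℤ), fun r => ?_⟩
  have hnat : ∀ (n : ℕ) (x : ℝ), Zfun A S (x + n * N) = Zfun A S x - n * k := by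
    intro n
    induction n with
    | zero => intro x; simp
    | succ n ih =>
      intro x
      have : x + ((n + 1 : ℕ) : ℝ) * N = (x + n * N) + N := by push_cast; ring
      rw [this, hp, ih]; push_cast; ring
  have hint : ∀ (n : ℤ) (x : ℝ), Zfun A S (x + n * N) = Zfun A S x - n * k := by
    intro n x
    rcases Int.eq_nat_or_neg n with ⟨m, rfl | rfl⟩
    · simpa using hnat m x
    · have := hnat m (x + ((-(m:ℤ) : ℤ) : ℝ) * N)
      have e : x + ((-(m:ℤ) : ℤ) : ℝ) * N + m * N = x := by push_cast; ring
      rw [e] at this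
      linarith
  set n := ⌊r / N⌋ with hn
  have h1 : (n : ℝ) * N ≤ r := (le_div_iff₀ hN).1 (Int.floor_le _)
  have h2 : r < ((n : ℝ) + 1) * N := (div_lt_iff₀ hN).1 (Int.lt_floor_add_one _)
  have e := hint n (r - n * N)
  rw [sub_add_cancel] at e
  have hx0 : 0 ≤ r - n * N := by linarith
  have hxN : r - n * N ≤ N := by linarith
  have hz := Z_sub hA hS hx0
  have h00 : Zfun A S 0 = 0 := by simp [Zfun]
  have cA := cnt_add hA hx0 hxN
  have cS := cnt_add hS hx0 hxN
  rw [h00] at hz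
  rw [e]
  zify at cA cS
  constructor <;> linarith [Int.natCast_nonneg (A ∩ Ioc 0 (r - n * N)).ncard,
    Int.natCast_nonneg (S ∩ Ioc 0 (r - n * N)).ncard,
    Int.natCast_nonneg (A ∩ Ioc (r - n * N) N).ncard,
    Int.natCast_nonneg (S ∩ Ioc (r - n * N) N).ncard]

/-- periodic case. If `A, S` are disjoint locally finite sets, periodic with
period `N > 0`, with `|S ∩ [0,N)| > |A ∩ [0,N)|`, then `(A,S)` is admissible, the queue
length `Q_r = Z_r - min_{r' ≤ r} Z_{r'}` is well defined and `N`-periodic, vanishes at every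
unused service time, and is the minimal solution of the queue equation: any nonnegative
right-continuous `Q' : ℝ → ℤ` with left limits `Q'm`, locally constant off `A ∪ S`, with
`Q'_r = Q'_{r-} + 1` for `r ∈ A` and `Q'_r = Q'_{r-} - 1{Q'_{r-} > 0}` for `r ∈ S`,
dominates `Q`. -/
theorem periodic_queue_minimal (N : ℝ) (hN : 0 < N) (A S : Set ℝ)
    (hA : LocFin A) (hS : LocFin S) (hd : Disjoint A S)
    (hpA : ∀ r : ℝ, r ∈ A ↔ r + N ∈ A) (hpS : ∀ r : ℝ, r ∈ S ↔ r + N ∈ S)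
    (hcount : (A ∩ Set.Ico 0 N).ncard < (S ∩ Set.Ico 0 N).ncard) :
    Admissible A S ∧
    (∀ r : ℝ, Qlen A S (r + N) = Qlen A S r) ∧
    (∀ r ∈ Unused A S, Qlen A S r = 0) ∧
    (∀ Q' Q'm : ℝ → ℤ,
      (∀ r : ℝ, 0 ≤ Q' r) →
      (∀ r : ℝ, ∀ᶠ r' in nhdsWithin r (Set.Iio r), Q' r' = Q'm r) →
      (∀ r : ℝ, ∀ᶠ r' in nhdsWithin r (Set.Ici r), Q' r' = Q' r) →
      (∀ r : ℝ, r ∉ A ∪ S → ∀ᶠ r' in nhds r, Q' r' = Q' r) →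
      (∀ r ∈ A, Q' r = Q'm r + 1) →
      (∀ r ∈ S, Q' r = Q'm r - (if 0 < Q'm r then 1 else 0)) →
      ∀ r : ℝ, Qlen A S r ≤ Q' r) := by
  have hper := Z_period hA hS hN hpA hpS
  set k : ℤ := ((S ∩ Ico 0 N).ncard : ℤ) - ((A ∩ Ico 0 N).ncard : ℤ) with hk
  have hk1 : 1 ≤ k := by omega
  obtain ⟨M, hM⟩ := Z_floor hA hS hN hper
  have hle : ∀ r, IsLeast (Zfun A S '' Iic r) (sInf (Zfun A S '' Iic r)) := by
    intro r
    have hb : BddBelow (Zfun A S '' Iic r) := by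
      refine ⟨-M - ⌊r / N⌋ * k, ?_⟩
      rintro _ ⟨x, hx, rfl⟩
      have hx' : x ≤ r := hx
      have h1 : ⌊x / N⌋ ≤ ⌊r / N⌋ := Int.floor_le_floor (by gcongr)
      have h2 := (hM x).2
      nlinarith
    have hne : (Zfun A S '' Iic r).Nonempty := ⟨_, r, self_mem_Iic, rfl⟩
    exact ⟨Int.csInf_mem hne hb, fun y hy => csInf_le hb hy⟩
  refine ⟨⟨hA, hS, hd, ?_, ?_⟩, ?_, ?_, ?_⟩
  · rw [tendsto_atTop_atBot]
    intro b
    refine ⟨(max 0 (M - b) : ℤ) * N, fun r hr => ?_⟩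
    have h1 : max 0 (M - b) ≤ ⌊r / N⌋ := Int.le_floor.2 ((le_div_iff₀ hN).2 hr)
    have h2 := (hM r).1
    have h3 := (le_max_left 0 (M - b)).trans h1
    have h4 := (le_max_right 0 (M - b)).trans h1
    nlinarith
  · rw [tendsto_atBot_atTop]
    intro b
    refine ⟨(min 0 (-M - b) : ℤ) * N, fun r hr => ?_⟩
    have h1 : ⌊r / N⌋ ≤ min 0 (-M - b) := by
      have : r / N ≤ ((min 0 (-M - b) : ℤ) : ℝ) := (div_le_iff₀ hN).2 hr
      exact_mod_cast (Int.floor_le _).trans this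
    have h2 := (hM r).2
    have h3 := h1.trans (min_le_left _ _)
    have h4 := h1.trans (min_le_right _ _)
    nlinarith
  · intro r
    have : IsLeast (Zfun A S '' Iic (r + N)) (sInf (Zfun A S '' Iic r) - k) := by
      obtain ⟨⟨x, hx, hxe⟩, hlow⟩ := hle r
      have hx' : x ≤ r := hx
      refine ⟨⟨x + N, ?_, ?_⟩, ?_⟩
      · simpa using hx'
      · rw [hper, hxe]
      · rintro _ ⟨y, hy, rfl⟩
        have hy' : y ≤ r + N := hy
        have h1 := hlow ⟨y - N, (show y - N ≤ r by linarith), rfl⟩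
        have h2 := hper (y - N)
        rw [sub_add_cancel] at h2
        linarith
    unfold Qlen
    rw [(hle (r + N)).unique this, hper]
    ring
  · rintro r ⟨_, hr⟩
    have : IsLeast (Zfun A S '' Iic r) (Zfun A S r) := by
      refine ⟨⟨r, self_mem_Iic, rfl⟩, ?_⟩
      rintro _ ⟨y, hy, rfl⟩
      rcases (show y ≤ r from hy).eq_or_lt with h | h
      · rw [h]
      · exact (hr y h).le
    unfold Qlen
    rw [(hle r).unique this, sub_self]
  · intro Q' Q'm h0 hl hr hc hQA hQS r
    obtain ⟨⟨r0, hr0, hr0e⟩, _⟩ := hle r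
    have hmono := mono_of_local (g := fun t => Q' t - Zfun A S t) ?_ ?_
      (show r0 ≤ r from hr0)
    · have := h0 r0
      unfold Qlen
      rw [← hr0e]
      linarith
    · intro t
      have hlc : t ∉ A ∪ S → ∀ᶠ u in nhdsWithin t (Iio t), Q' u = Q' t :=
        fun ht => (hc t ht).filter_mono nhdsWithin_le_nhds
      have hlc' : ∀ᶠ u in nhdsWithin t (Iio t), t ∉ A ∪ S → Q' u = Q' t := by
        by_cases ht : t ∈ A ∪ S
        · exact Eventually.of_forall fun u h => absurd ht h
        · filter_upwards [hlc ht] with u hu _ using hu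
      filter_upwards [hl t, hlc', (isolated hA t).filter_mono nhdsWithin_le_nhds,
        (isolated hS t).filter_mono nhdsWithin_le_nhds, self_mem_nhdsWithin] with u h1 h2 h3 h4 hu
      have hu' : u < t := hu
      have hz := Z_sub hA hS hu'.le
      rw [h3 hu', h4 hu'] at hz
      by_cases hta : t ∈ A
      · have hts : t ∉ S := fun h => Set.disjoint_left.1 hd hta h
        rw [inter_singleton_eq_empty.2 hts, inter_singleton_of_mem hta] at hz
        simp at hz
        have := hQA t hta
        linarith
      · by_cases hts : t ∈ S
        · rw [inter_singleton_eq_empty.2 hta, inter_singleton_of_mem hts] at hz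
          simp at hz
          have := hQS t hts
          split_ifs at this <;> linarith
        · rw [inter_singleton_eq_empty.2 hta, inter_singleton_eq_empty.2 hts] at hz
          simp at hz
          have := h2 (by simp [hta, hts])
          linarith
    · intro t
      filter_upwards [(hr t).filter_mono (nhdsWithin_mono t Ioi_subset_Ici_self),
        (isolated_right hA t).filter_mono nhdsWithin_le_nhds,
        (isolated_right hS t).filter_mono nhdsWithin_le_nhds, self_mem_nhdsWithin]
        with u h1 h3 h4 hu
      have hu' : t < u := hu
      have hz := Z_sub hA hS hu'.le
      rw [h3 hu', h4 hu'] at hz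
      simp at hz
      linarith
end
end
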